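/- Suppose p(0) = a₀ ≠ 0. Let c > 0 and let L be an affine map of ℂ², i.e. L(x,y) = (a₁x + a₂y + a₃, b₁x + b₂y + b₃), with L(Ω_c) = Ω_c. Then L is the identity map of ℂ². -/

import Mathlib

open Filter Topology Set

noncomputable section

/-- `L : ℂ² → ℂ²` is an affine map. -/
def IsAffine (L : ℂ × ℂ → ℂ × ℂ) : Prop :=
  ∃ a₁ a₂ a₃ b₁ b₂ b₃ : ℂ, ∀ z : ℂ × ℂ,
    L z = (a₁ * z.1 + a₂ * z.2 + a₃, b₁ * z.1 + b₂ * z.2 + b₃)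

/-- growth of a polynomial of degree at least two. -/
lemma poly_growth (p : Polynomial ℂ) (hp : 2 ≤ p.natDegree) (K : ℝ) (hK : 0 ≤ K) :
    ∃ C : ℝ, ∀ w : ℂ, K * ‖w‖ ≤ ‖p.eval w‖ + C := by
  have hdeg : 0 < p.divX.degree := by
    apply Polynomial.natDegree_pos_iff_degree_pos.mp
    rw [Polynomial.natDegree_divX_eq_natDegree_tsub_one]; omega
  have ht : Tendsto (fun w : ℂ => ‖p.divX.eval w‖) (Bornology.cobounded ℂ) atTop :=
    Polynomial.tendsto_norm_atTop _ hdeg tendsto_norm_cobounded_atTop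
  have he := ht.eventually (eventually_ge_atTop K)
  rw [← comap_norm_atTop, eventually_comap] at he
  obtain ⟨R, hR⟩ := eventually_atTop.mp he
  refine ⟨‖p.coeff 0‖ + K * |R|, fun w => ?_⟩
  by_cases hw : R ≤ ‖w‖
  · have h1 := hR _ hw w rfl
    have h2 : p.divX.eval w * w = p.eval w - p.coeff 0 := by
      conv_rhs => rw [← Polynomial.divX_mul_X_add p]
      simp
    have h3 : ‖p.divX.eval w‖ * ‖w‖ ≤ ‖p.eval w‖ + ‖p.coeff 0‖ := by
      rw [← norm_mul, h2]; exact norm_sub_le _ _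
    have h4 : K * ‖w‖ ≤ ‖p.divX.eval w‖ * ‖w‖ := by gcongr
    have : 0 ≤ K * |R| := by positivity
    linarith
  · push Not at hw
    have h1 : K * ‖w‖ ≤ K * |R| := by
      gcongr; exact hw.le.trans (le_abs_self R)
    have := norm_nonneg (p.eval w)
    have := norm_nonneg (p.coeff 0)
    linarith

/-- a polynomial with sublinear growth is constant. -/
lemma poly_const (q : Polynomial ℂ)
    (h : ∀ ε : ℝ, 0 < ε → ∃ C : ℝ, ∀ y : ℂ, ‖q.eval y‖ ≤ ε * ‖y‖ + C) :
    ∃ k : ℂ, q = Polynomial.C k := by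
  have hle : q.natDegree ≤ 1 := by
    by_contra hcon
    push Not at hcon
    obtain ⟨C, hC⟩ := h 1 one_pos
    obtain ⟨C', hC'⟩ := poly_growth q hcon 2 (by norm_num)
    have h1 := hC ((|C| + |C'| + 1 : ℝ) : ℂ)
    have h2 := hC' ((|C| + |C'| + 1 : ℝ) : ℂ)
    have h3 : ‖((|C| + |C'| + 1 : ℝ) : ℂ)‖ = |C| + |C'| + 1 := by
      rw [Complex.norm_real, Real.norm_of_nonneg (by positivity)]
    rw [h3] at h1 h2
    have := le_abs_self C
    have := le_abs_self C'
    linarith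
  obtain ⟨u, v, rfl⟩ := Polynomial.exists_eq_X_add_C_of_natDegree_le_one hle
  by_cases hu : u = 0
  · exact ⟨v, by simp [hu]⟩
  exfalso
  have hu' : 0 < ‖u‖ := norm_pos_iff.mpr hu
  obtain ⟨C, hC⟩ := h (‖u‖ / 2) (by positivity)
  set t : ℝ := 2 * (|C| + ‖v‖ + 1) / ‖u‖ with htdef
  have htn : 0 ≤ t := by positivity
  have h1 := hC (t : ℂ)
  have h3 : ‖(t : ℂ)‖ = t := by
    rw [Complex.norm_real, Real.norm_of_nonneg htn]
  have h4 : ‖u‖ * t ≤ ‖u * (t:ℂ) + v‖ + ‖v‖ := by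
    have := norm_sub_le (u * (t:ℂ) + v) v
    rw [add_sub_cancel_right, norm_mul, h3] at this
    exact this
  simp only [Polynomial.eval_add, Polynomial.eval_mul, Polynomial.eval_C, Polynomial.eval_X] at h1
  rw [h3] at h1
  have h5 : ‖u‖ * t = 2 * (|C| + ‖v‖ + 1) := by
    rw [htdef]; field_simp
  have := le_abs_self C
  linarith

/-- forward escape estimate. -/
lemma escape_step (d : ℕ) (hd : 2 ≤ d) (a : ℂ) (p : Polynomial ℂ) (hpm : p.Monic)
    (hpd : p.natDegree = d) :
    ∃ R : ℝ, 4 ≤ R ∧ ∀ x y : ℂ, R ≤ ‖y‖ → ‖x‖ ≤ ‖y‖ →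
      ‖y‖ ^ d / 2 ≤ ‖p.eval y - a * x‖ := by
  have h0 : Tendsto (fun y : ℂ => ‖p.reverse.eval y⁻¹‖) (Bornology.cobounded ℂ) (𝓝 1) := by
    have h1 : Tendsto (fun y : ℂ => ‖p.reverse.eval y‖) (𝓝 0) (𝓝 ‖p.reverse.eval 0‖) :=
      (p.reverse.continuous.norm).tendsto 0
    have h2 : ‖p.reverse.eval 0‖ = 1 := by
      rw [← Polynomial.coeff_zero_eq_eval_zero, Polynomial.coeff_zero_reverse, hpm.leadingCoeff,
        norm_one]
    rw [h2] at h1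
    exact h1.comp tendsto_inv₀_cobounded
  have he := h0.eventually (eventually_ge_nhds (show (3/4 : ℝ) < 1 by norm_num))
  rw [← comap_norm_atTop, eventually_comap] at he
  obtain ⟨R, hR⟩ := eventually_atTop.mp he
  refine ⟨max (max R 4) (4 * ‖a‖), le_max_of_le_left (le_max_right _ _), fun x y hy hxy => ?_⟩
  have hyR : R ≤ ‖y‖ := le_trans (le_trans (le_max_left _ _) (le_max_left _ _)) hy
  have hy4 : 4 ≤ ‖y‖ := le_trans (le_trans (le_max_right _ _) (le_max_left _ _)) hy
  have hya : 4 * ‖a‖ ≤ ‖y‖ := le_trans (le_max_right _ _) hy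
  have hy0 : y ≠ 0 := by
    rintro rfl; norm_num at hy4
  have h1 := hR _ hyR y rfl
  have h2 : p.reverse.eval y⁻¹ * y ^ d = p.eval y := by
    have := invertibleOfNonzero hy0
    have := Polynomial.eval₂_reverse_mul_pow (RingHom.id ℂ) y p
    rw [hpd, invOf_eq_inv] at this
    exact this
  have h3 : 3 / 4 * ‖y‖ ^ d ≤ ‖p.eval y‖ := by
    rw [← h2, norm_mul, norm_pow]; gcongr
  have h4 : ‖a * x‖ ≤ ‖y‖ ^ d / 4 := by
    rw [norm_mul]
    have : ‖y‖ ^ 2 ≤ ‖y‖ ^ d := pow_le_pow_right₀ (by linarith) hd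
    have : ‖a‖ * ‖x‖ ≤ (‖y‖ / 4) * ‖y‖ := by
      gcongr; linarith
    nlinarith
  have h5 := norm_sub_norm_le (p.eval y) (a * x)
  linarith

/-- coefficients of `p(b y + e)`. -/
lemma comp_coeffs (d : ℕ) (hd : 2 ≤ d) (p : Polynomial ℂ) (hpm : p.Monic)
    (hpd : p.natDegree = d) (hpc : p.coeff (d - 1) = 0) (b e α β k : ℂ)
    (h : ∀ y, p.eval (b * y + e) - α * p.eval y - β * y = k) :
    b ^ d = α ∧ (b ≠ 0 → β = 0 → e = 0) := by
  have hpol : (Polynomial.taylor e p).comp (Polynomial.C b * Polynomial.X) =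
      Polynomial.C α * p + Polynomial.C β * Polynomial.X + Polynomial.C k := by
    apply Polynomial.funext
    intro y
    have := h y
    simp only [Polynomial.eval_comp, Polynomial.eval_add, Polynomial.eval_mul, Polynomial.eval_C,
      Polynomial.eval_X, Polynomial.taylor_eval]
    linear_combination this
  have hc : p.coeff d = 1 := by rw [← hpd]; exact hpm
  have hd0 : d ≠ 0 := by omega
  have hdm : (Polynomial.hasseDeriv d p).eval e = 1 := by
    have h1 : (Polynomial.hasseDeriv d p).natDegree ≤ 0 := by
      have := Polynomial.natDegree_hasseDeriv_le p d
      omega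
    rw [Polynomial.eval_eq_sum_range' (n := 1) (by omega)]
    simp [Polynomial.hasseDeriv_coeff, hc]
  have hdm1 : (Polynomial.hasseDeriv (d-1) p).eval e = d * e := by
    have h1 : (Polynomial.hasseDeriv (d-1) p).natDegree ≤ 1 := by
      have := Polynomial.natDegree_hasseDeriv_le p (d-1)
      omega
    rw [Polynomial.eval_eq_sum_range' (n := 2) (by omega)]
    have h2 : 1 + (d - 1) = d := by omega
    simp [Polynomial.hasseDeriv_coeff, Finset.sum_range_succ, hpc, h2, hc]
    left
    have := Nat.choose_symm (n := d) (k := 1) (by omega)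
    rw [this]; simp
  constructor
  · have h1 := congrArg (fun q => Polynomial.coeff q d) hpol
    simp [Polynomial.comp_C_mul_X_coeff, Polynomial.taylor_coeff, hdm, hc,
      Polynomial.coeff_X, Polynomial.coeff_C, hd0, show (1:ℕ) ≠ d by omega] at h1
    exact h1
  · intro hb hβ
    have h1 := congrArg (fun q => Polynomial.coeff q (d-1)) hpol
    simp [Polynomial.comp_C_mul_X_coeff, Polynomial.taylor_coeff, hdm1, hpc, hβ,
      Polynomial.coeff_C, hd0, hb, show d - 1 ≠ 0 by omega] at h1
    exact h1

lemma green_H (d : ℕ) (hd : 2 ≤ d) (H : ℂ × ℂ → ℂ × ℂ) (G : ℂ × ℂ → ℝ)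
    (hGlim : ∀ z : ℂ × ℂ,
      Tendsto (fun n : ℕ => Real.log (max ‖H^[n] z‖ 1) / (d : ℝ) ^ n) atTop (𝓝 (G z)))
    (z : ℂ × ℂ) : G (H z) = d * G z := by
  have h1 := hGlim (H z)
  have h2 := ((hGlim z).comp (tendsto_add_atTop_nat 1)).const_mul (d : ℝ)
  refine tendsto_nhds_unique h1 (h2.congr fun n => ?_)
  have : (d : ℝ) ≠ 0 := by positivity
  simp only [Function.comp, Function.iterate_succ_apply]
  field_simp
  ring

lemma green_iter (d : ℕ) (H : ℂ × ℂ → ℂ × ℂ) (G : ℂ × ℂ → ℝ)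
    (hGH : ∀ z, G (H z) = d * G z) (n : ℕ) (z : ℂ × ℂ) : G (H^[n] z) = (d : ℝ) ^ n * G z := by
  induction n generalizing z with
  | zero => simp
  | succ n ih => rw [Function.iterate_succ_apply, ih, hGH]; ring

/-- The Green function controls `y` in the forward escape region. -/
lemma green_bound (d : ℕ) (hd : 2 ≤ d) (a : ℂ)
    (p : Polynomial ℂ) (hpm : p.Monic) (hpd : p.natDegree = d)
    (H : ℂ × ℂ → ℂ × ℂ) (hH : ∀ z : ℂ × ℂ, H z = (z.2, p.eval z.2 - a * z.1))
    (G : ℂ × ℂ → ℝ)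
    (hGlim : ∀ z : ℂ × ℂ,
      Tendsto (fun n : ℕ => Real.log (max ‖H^[n] z‖ 1) / (d : ℝ) ^ n) atTop (𝓝 (G z)))
    (c : ℝ) :
    ∃ M : ℝ, ∀ z : ℂ × ℂ, G z < c → ‖z.2‖ ≤ M + ‖z.1‖ := by
  obtain ⟨R, hR4, hR⟩ := escape_step d hd a p hpm hpd
  have hstep : ∀ z : ℂ × ℂ, R ≤ ‖z.2‖ → ‖z.1‖ ≤ ‖z.2‖ →
      R ≤ ‖(H z).2‖ ∧ ‖(H z).1‖ ≤ ‖(H z).2‖ ∧ ‖z.2‖ ^ d / 2 ≤ ‖(H z).2‖ := by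
    intro z h1 h2
    have h3 := hR z.1 z.2 h1 h2
    have h4 : ‖z.2‖ ^ 2 ≤ ‖z.2‖ ^ d := pow_le_pow_right₀ (by linarith) hd
    have h5 : ‖z.2‖ ≤ ‖z.2‖ ^ d / 2 := by nlinarith
    rw [hH]
    exact ⟨by linarith, by simpa using h5.trans h3, h3⟩
  have hiter : ∀ n : ℕ, ∀ z : ℂ × ℂ, R ≤ ‖z.2‖ → ‖z.1‖ ≤ ‖z.2‖ →
      (‖z.2‖ / 2) ^ (d ^ n) ≤ ‖(H^[n] z).2‖ / 2 := by
    intro n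
    induction n with
    | zero => intro z _ _; simp
    | succ n ih =>
      intro z h1 h2
      obtain ⟨h3, h4, h5⟩ := hstep z h1 h2
      have h6 := ih (H z) h3 h4
      rw [Function.iterate_succ_apply, pow_succ' d n, pow_mul]
      refine le_trans ?_ h6
      gcongr
      rw [div_pow]
      have h7 : (4 : ℝ) ≤ 2 ^ d := by
        calc (4 : ℝ) = 2 ^ 2 := by norm_num
          _ ≤ 2 ^ d := pow_le_pow_right₀ (by norm_num) hd
      calc ‖z.2‖ ^ d / 2 ^ d ≤ ‖z.2‖ ^ d / 4 := by gcongr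
        _ ≤ _ := by linarith
  refine ⟨max R (2 * Real.exp c), fun z hz => ?_⟩
  by_contra hcon
  push Not at hcon
  have hzn := norm_nonneg z.1
  have h1 : R ≤ ‖z.2‖ := by linarith [le_max_left R (2 * Real.exp c)]
  have h2 : ‖z.1‖ ≤ ‖z.2‖ := by linarith [le_max_left R (2 * Real.exp c)]
  have h3 : 2 * Real.exp c ≤ ‖z.2‖ := by linarith [le_max_right R (2 * Real.exp c)]
  have h4 : c ≤ Real.log (‖z.2‖ / 2) := by
    rw [Real.le_log_iff_exp_le (by linarith)]; linarith
  refine absurd hz (not_lt.mpr (ge_of_tendsto' (hGlim z) fun n => h4.trans ?_))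
  rw [le_div_iff₀ (by positivity)]
  have h5 := hiter n z h1 h2
  have h6 : ‖(H^[n] z).2‖ ≤ ‖H^[n] z‖ := norm_snd_le _
  have h7 : (‖z.2‖ / 2) ^ (d ^ n) ≤ max ‖H^[n] z‖ 1 := by
    refine le_trans ?_ (le_max_left _ _)
    have := norm_nonneg (H^[n] z).2
    linarith
  have h8 := Real.log_le_log (by apply pow_pos; linarith) h7
  rw [Real.log_pow] at h8
  push_cast at h8
  linarith

/-- sublinear bound of `y` on sublevel sets. -/
lemma green_small (d : ℕ) (hd : 2 ≤ d) (a : ℂ) (ha : a ≠ 0)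
    (p : Polynomial ℂ) (hpm : p.Monic) (hpd : p.natDegree = d)
    (H : ℂ × ℂ → ℂ × ℂ) (hH : ∀ z : ℂ × ℂ, H z = (z.2, p.eval z.2 - a * z.1))
    (G : ℂ × ℂ → ℝ)
    (hGlim : ∀ z : ℂ × ℂ,
      Tendsto (fun n : ℕ => Real.log (max ‖H^[n] z‖ 1) / (d : ℝ) ^ n) atTop (𝓝 (G z)))
    (c : ℝ) (ε : ℝ) (hε : 0 < ε) :
    ∃ C : ℝ, 0 ≤ C ∧ ∀ z : ℂ × ℂ, G z < c → ‖z.2‖ ≤ ε * ‖z.1‖ + C := by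
  obtain ⟨M, hM⟩ := green_bound d hd a p hpm hpd H hH G hGlim (d * c)
  obtain ⟨C, hC⟩ := poly_growth p (by omega) (1 + ‖a‖ / ε) (by positivity)
  have ha' : 0 < ‖a‖ := norm_pos_iff.mpr ha
  refine ⟨ε / ‖a‖ * (|M| + |C|), by positivity, fun z hz => ?_⟩
  have h1 : G (H z) < d * c := by
    rw [green_H d hd H G hGlim]
    have : (0:ℝ) < d := by positivity
    gcongr
  have h2 := hM _ h1
  rw [hH] at h2
  simp only at h2
  have h3 := hC z.2
  have h4 := norm_sub_norm_le (p.eval z.2) (a * z.1)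
  rw [norm_mul] at h4
  have h5 : ‖a‖ / ε * ‖z.2‖ ≤ ‖a‖ * ‖z.1‖ + (|M| + |C|) := by
    have := le_abs_self M
    have := le_abs_self C
    linarith
  have h6 : ε / ‖a‖ * (‖a‖ / ε * ‖z.2‖) ≤ ε / ‖a‖ * (‖a‖ * ‖z.1‖ + (|M| + |C|)) := by
    gcongr
  have h7 : ε / ‖a‖ * (‖a‖ / ε * ‖z.2‖) = ‖z.2‖ := by field_simp
  have h8 : ε / ‖a‖ * (‖a‖ * ‖z.1‖ + (|M| + |C|)) = ε * ‖z.1‖ + ε / ‖a‖ * (|M| + |C|) := by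
    field_simp
  linarith

/-- every iterate has a point on the vertical line with vanishing second coordinate. -/
lemma exists_root (d : ℕ) (hd : 2 ≤ d) (a : ℂ)
    (p : Polynomial ℂ) (hpd : p.natDegree = d)
    (H : ℂ × ℂ → ℂ × ℂ) (hH : ∀ z : ℂ × ℂ, H z = (z.2, p.eval z.2 - a * z.1))
    (x : ℂ) (n : ℕ) : ∃ w : ℂ, (H^[n] (x, w)).2 = 0 := by
  have key : ∃ A B : Polynomial ℂ, A.natDegree < B.natDegree ∧
      ∀ w, H^[n] (x, w) = (A.eval w, B.eval w) := by
    induction n with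
    | zero => exact ⟨Polynomial.C x, Polynomial.X, by simp, by simp⟩
    | succ n ih =>
      obtain ⟨A, B, h1, h2⟩ := ih
      refine ⟨B, p.comp B - Polynomial.C a * A, ?_, fun w => ?_⟩
      · have h3 : (p.comp B).natDegree = d * B.natDegree := by
          rw [Polynomial.natDegree_comp, hpd]
        have h4 : (Polynomial.C a * A).natDegree ≤ A.natDegree := Polynomial.natDegree_C_mul_le _ _
        have h5 : B.natDegree < d * B.natDegree := by nlinarith
        rw [Polynomial.natDegree_sub_eq_left_of_natDegree_lt (by omega)]
        omega
      · rw [Function.iterate_succ_apply', h2, hH]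
        simp
  obtain ⟨A, B, h1, h2⟩ := key
  obtain ⟨w, hw⟩ := IsAlgClosed.exists_root B (by
    apply ne_of_gt
    apply Polynomial.natDegree_pos_iff_degree_pos.mp; omega)
  exact ⟨w, by rw [h2]; exact hw⟩

/-- each vertical line meets each sublevel set. -/
lemma exists_small (d : ℕ) (hd : 2 ≤ d) (a : ℂ) (ha : a ≠ 0)
    (p : Polynomial ℂ) (hpd : p.natDegree = d)
    (H : ℂ × ℂ → ℂ × ℂ) (hH : ∀ z : ℂ × ℂ, H z = (z.2, p.eval z.2 - a * z.1))
    (G : ℂ × ℂ → ℝ) (hGcont : Continuous G) (hGH : ∀ z, G (H z) = d * G z)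
    (c : ℝ) (hc : 0 < c) (x : ℂ) : ∃ w : ℂ, G (x, w) < c := by
  obtain ⟨C, hC⟩ := poly_growth p (by omega) (2 * ‖a‖ + 2) (by positivity)
  have ha' : 0 < ‖a‖ := norm_pos_iff.mpr ha
  have hback : ∀ n : ℕ, ∀ z : ℂ × ℂ, |C| + 1 < ‖(H^[n] z).1‖ →
      ‖(H^[n] z).2‖ ≤ ‖(H^[n] z).1‖ →
      2 ^ n * ‖(H^[n] z).1‖ ≤ ‖z.1‖ ∧ ‖z.2‖ ≤ ‖z.1‖ := by
    intro n
    induction n with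
    | zero => intro z _ h; exact ⟨by simp, by simpa using h⟩
    | succ n ih =>
      intro z h1 h2
      rw [Function.iterate_succ_apply] at h1 h2 ⊢
      obtain ⟨h3, h4⟩ := ih (H z) h1 h2
      have h0 : ‖(H^[n] (H z)).1‖ ≤ 2 ^ n * ‖(H^[n] (H z)).1‖ :=
        le_mul_of_one_le_left (norm_nonneg _) (one_le_pow₀ (by norm_num))
      rw [pow_succ']
      set T := 2 ^ n * ‖(H^[n] (H z)).1‖ with hT
      rw [hH] at h3 h4
      simp only at h3 h4
      have h5 := hC z.2
      have h6 : ‖p.eval z.2‖ ≤ ‖p.eval z.2 - a * z.1‖ + ‖a‖ * ‖z.1‖ := by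
        have := norm_add_le (p.eval z.2 - a * z.1) (a * z.1)
        rwa [sub_add_cancel, norm_mul] at this
      have h7 : ‖a‖ * (2 * ‖z.2‖) ≤ ‖a‖ * ‖z.1‖ := by
        have := le_abs_self C
        linarith
      have h8 := le_of_mul_le_mul_left h7 ha'
      have := norm_nonneg z.2
      rw [mul_assoc, ← hT]
      exact ⟨by linarith, by linarith⟩
  obtain ⟨B, hB⟩ := ((isCompact_closedBall (0 : ℂ × ℂ) (|C| + 1)).image hGcont).bddAbove
  obtain ⟨n, hn⟩ := pow_unbounded_of_one_lt (max ‖x‖ (|B| / c)) (one_lt_two (α := ℝ))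
  obtain ⟨w, hw⟩ := exists_root d hd a p hpd H hH x n
  refine ⟨w, ?_⟩
  have hsmall : ‖(H^[n] (x, w)).1‖ ≤ |C| + 1 := by
    by_contra hcon
    push Not at hcon
    have h1 := (hback n (x, w) hcon (by rw [hw, norm_zero]; exact norm_nonneg _)).1
    simp only at h1
    have h2 : (2:ℝ) ^ n * 1 ≤ 2 ^ n * ‖(H^[n] (x, w)).1‖ := by
      gcongr
      linarith [abs_nonneg C]
    have := le_max_left ‖x‖ (|B| / c)
    linarith
  have hmem : H^[n] (x, w) ∈ Metric.closedBall (0 : ℂ × ℂ) (|C| + 1) := by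
    rw [mem_closedBall_zero_iff, Prod.norm_def, hw, norm_zero]
    exact max_le hsmall (by positivity)
  have h1 : G (H^[n] (x, w)) ≤ B := hB ⟨_, hmem, rfl⟩
  rw [green_iter d H G hGH] at h1
  have h2 : |B| / c < (d : ℝ) ^ n := by
    calc |B| / c ≤ max ‖x‖ (|B| / c) := le_max_right _ _
      _ < 2 ^ n := hn
      _ ≤ (d : ℝ) ^ n := by gcongr; exact_mod_cast hd
  rw [div_lt_iff₀ hc] at h2
  have h3 : (d : ℝ) ^ n * G (x, w) < (d : ℝ) ^ n * c := by linarith [le_abs_self B]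
  exact lt_of_mul_lt_mul_left h3 (by positivity)

/-- The key step: conjugating by `H` gives an affine map again. -/
lemma key_step (d : ℕ) (hd : 2 ≤ d) (a : ℂ) (ha : a ≠ 0)
    (p : Polynomial ℂ) (hpm : p.Monic) (hpd : p.natDegree = d)
    (H : ℂ × ℂ → ℂ × ℂ) (hH : ∀ z : ℂ × ℂ, H z = (z.2, p.eval z.2 - a * z.1))
    (G : ℂ × ℂ → ℝ) (hGcont : Continuous G)
    (hGlim : ∀ z : ℂ × ℂ,
      Tendsto (fun n : ℕ => Real.log (max ‖H^[n] z‖ 1) / (d : ℝ) ^ n) atTop (𝓝 (G z)))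
    (c : ℝ) (hc : 0 < c) (α β γ b e : ℂ)
    (hL : ∀ x y : ℂ, G (x, y) < c → G (α * x + β * y + γ, b * y + e) < c) :
    ∃ k : ℂ, (∀ y, p.eval (b * y + e) - α * p.eval y - a * β * y - a * γ = k) ∧
      ∀ x y : ℂ, G (x, y) < d * c → G (b * x + 0 * y + e, α * y + k) < d * c := by
  have hGH := green_H d hd H G hGlim
  have hd0 : (0:ℝ) < d := by positivity
  set q : Polynomial ℂ := p.comp (Polynomial.C b * Polynomial.X + Polynomial.C e)
    - Polynomial.C α * p - Polynomial.C (a * β) * Polynomial.X - Polynomial.C (a * γ) with hq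
  have hqe : ∀ y, q.eval y = p.eval (b * y + e) - α * p.eval y - a * β * y - a * γ := by
    intro y; simp [hq]
  have hconj : ∀ y w : ℂ, G (y, w) < d * c → G (b * y + e, α * w + q.eval y) < d * c := by
    intro y w hyw
    have h1 : H ((p.eval y - w) / a, y) = (y, w) := by
      rw [hH]; simp only [Prod.mk.injEq, true_and]; field_simp; ring
    rw [← h1, hGH] at hyw
    have h2 := hL _ _ (lt_of_mul_lt_mul_left hyw hd0.le)
    have h3 : (b * y + e, α * w + q.eval y) =
        H (α * ((p.eval y - w) / a) + β * y + γ, b * y + e) := by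
      rw [hH, hqe]; simp only [Prod.mk.injEq, true_and]; field_simp; ring
    rw [h3, hGH]
    gcongr
  have hconst : ∃ k, q = Polynomial.C k := by
    apply poly_const
    intro ε hε
    set δ := ε / (‖α‖ + ‖b‖ + 1) with hδ
    have hden : 0 < ‖α‖ + ‖b‖ + 1 := by positivity
    have hδ0 : 0 < δ := by positivity
    obtain ⟨C, hC0, hC⟩ := green_small d hd a ha p hpm hpd H hH G hGlim (d * c) δ hδ0
    refine ⟨δ * ‖e‖ + C + ‖α‖ * C, fun y => ?_⟩
    obtain ⟨w, hw⟩ := exists_small d hd a ha p hpd H hH G hGcont hGH (d * c) (by positivity) y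
    have h1 := hC _ hw
    have h2 := hC _ (hconj y w hw)
    simp only at h1 h2
    have h3 : ‖q.eval y‖ ≤ ‖α * w + q.eval y‖ + ‖α‖ * ‖w‖ := by
      have := norm_sub_le (α * w + q.eval y) (α * w)
      rwa [add_sub_cancel_left, norm_mul] at this
    have h4 : ‖b * y + e‖ ≤ ‖b‖ * ‖y‖ + ‖e‖ := by
      have := norm_add_le (b * y) e
      rwa [norm_mul] at this
    have h5 : δ * ‖b * y + e‖ ≤ δ * (‖b‖ * ‖y‖ + ‖e‖) := by gcongr
    have h6 : ‖α‖ * ‖w‖ ≤ ‖α‖ * (δ * ‖y‖ + C) := by gcongr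
    have h7 : ε = δ * (‖α‖ + ‖b‖ + 1) := by rw [hδ]; field_simp
    have h8 : 0 ≤ δ * ‖y‖ := by positivity
    rw [h7]
    linarith
  obtain ⟨k, hk⟩ := hconst
  refine ⟨k, fun y => by rw [← hqe, hk, Polynomial.eval_C], fun x y hxy => ?_⟩
  have := hconj x y hxy
  rw [hk, Polynomial.eval_C] at this
  simpa using this

/-- Suppose `p(0) = a₀ ≠ 0`. Let `c > 0` and let `L` be an affine map of
`ℂ²` with `L(Ω_c) = Ω_c`. Then `L` is the identity map of `ℂ²`. -/
theorem stmt_8 (d : ℕ) (hd : 2 ≤ d) (a : ℂ) (ha : a ≠ 0)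
    (p : Polynomial ℂ) (hpm : p.Monic) (hpd : p.natDegree = d)
    (hpc : p.coeff (d - 1) = 0) (hp0 : p.coeff 0 ≠ 0)
    (H : ℂ × ℂ → ℂ × ℂ) (hH : ∀ z : ℂ × ℂ, H z = (z.2, p.eval z.2 - a * z.1))
    (G : ℂ × ℂ → ℝ) (hGcont : Continuous G) (hGnonneg : ∀ z, 0 ≤ G z)
    (hGlim : ∀ z : ℂ × ℂ,
      Tendsto (fun n : ℕ => Real.log (max ‖H^[n] z‖ 1) / (d : ℝ) ^ n) atTop (𝓝 (G z)))
    (c : ℝ) (hc : 0 < c)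
    (L : ℂ × ℂ → ℂ × ℂ) (hLaff : IsAffine L)
    (hLΩ : L '' {z : ℂ × ℂ | G z < c} = {z : ℂ × ℂ | G z < c}) :
    L = id := by
  obtain ⟨a₁, a₂, a₃, b₁, b₂, b₃, hL⟩ := hLaff
  have hGH := green_H d hd H G hGlim
  have hd0 : (0:ℝ) < d := by positivity
  -- points with prescribed second coordinate
  have hpt : ∀ y : ℂ, ∃ x : ℂ, G (x, y) < c := by
    intro y
    obtain ⟨w, hw⟩ := exists_small d hd a ha p hpd H hH G hGcont hGH (d * c) (by positivity) y
    have h1 : H ((p.eval y - w) / a, y) = (y, w) := by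
      rw [hH]; simp only [Prod.mk.injEq, true_and]; field_simp; ring
    rw [← h1, hGH] at hw
    exact ⟨_, lt_of_mul_lt_mul_left hw hd0.le⟩
  have hmaps : ∀ z, G z < c → G (L z) < c := by
    intro z hz
    have : L z ∈ L '' {z : ℂ × ℂ | G z < c} := ⟨z, hz, rfl⟩
    rw [hLΩ] at this
    exact this
  have hb1 : b₁ = 0 := by
    by_contra hb
    have hb' : 0 < ‖b₁‖ := norm_pos_iff.mpr hb
    set K := ‖b₂‖ + ‖a₁‖ + ‖a₂‖ + 1 with hK
    have hK1 : 0 < K := by positivity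
    set ε := min 1 (‖b₁‖ / (2 * K)) with hεdef
    have hε : 0 < ε := by positivity
    have hε1 : ε ≤ 1 := min_le_left _ _
    have hεK : ε * K ≤ ‖b₁‖ / 2 := by
      have : ε ≤ ‖b₁‖ / (2 * K) := min_le_right _ _
      calc ε * K ≤ ‖b₁‖ / (2 * K) * K := by gcongr
        _ = ‖b₁‖ / 2 := by field_simp
    obtain ⟨C, hC0, hC⟩ := green_small d hd a ha p hpm hpd H hH G hGlim c ε hε
    set D := ‖b₂‖ * C + ‖b₃‖ + ‖a₂‖ * C + ‖a₃‖ + C with hD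
    have hD0 : 0 ≤ D := by positivity
    set t : ℝ := 2 * D / ‖b₁‖ + C + 1 with ht
    have ht0 : 0 ≤ t := by positivity
    obtain ⟨x, hx⟩ := hpt (t : ℂ)
    have h1 := hC _ hx
    have h2 := hC _ (hmaps _ hx)
    rw [hL] at h2
    simp only at h1 h2
    generalize hy : (t : ℂ) = y at *
    have hyn : ‖y‖ = t := by
      rw [← hy, Complex.norm_real, Real.norm_of_nonneg ht0]
    have hxn := norm_nonneg x
    have h3 : ‖b₁‖ * ‖x‖ ≤ ‖b₁ * x + b₂ * y + b₃‖ + ‖b₂‖ * ‖y‖ + ‖b₃‖ := by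
      have e1 := norm_sub_le (b₁ * x + b₂ * y + b₃) (b₂ * y + b₃)
      have e2 := norm_add_le (b₂ * y) b₃
      rw [show b₁ * x + b₂ * y + b₃ - (b₂ * y + b₃) = b₁ * x by ring, norm_mul] at e1
      rw [norm_mul] at e2
      linarith
    have h4 : ‖a₁ * x + a₂ * y + a₃‖ ≤ ‖a₁‖ * ‖x‖ + ‖a₂‖ * ‖y‖ + ‖a₃‖ := by
      have e1 := norm_add_le (a₁ * x + a₂ * y) a₃
      have e2 := norm_add_le (a₁ * x) (a₂ * y)
      rw [norm_mul, norm_mul] at e2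
      linarith
    have h5 : ε * ‖a₁ * x + a₂ * y + a₃‖ ≤ ε * (‖a₁‖ * ‖x‖) + ‖a₂‖ * ‖y‖ + ‖a₃‖ := by
      have e1 : ε * ‖a₁ * x + a₂ * y + a₃‖ ≤ ε * (‖a₁‖ * ‖x‖ + ‖a₂‖ * ‖y‖ + ‖a₃‖) := by gcongr
      have e2 : ε * (‖a₂‖ * ‖y‖ + ‖a₃‖) ≤ 1 * (‖a₂‖ * ‖y‖ + ‖a₃‖) := by gcongr
      linarith
    have h6 : ‖b₂‖ * ‖y‖ ≤ ‖b₂‖ * (ε * ‖x‖ + C) := by gcongr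
    have h7 : ‖a₂‖ * ‖y‖ ≤ ‖a₂‖ * (ε * ‖x‖ + C) := by gcongr
    have h8 : ‖b₁‖ * ‖x‖ ≤ ε * K * ‖x‖ + D := by
      have : 0 ≤ ε * ‖x‖ := by positivity
      rw [hK, hD]
      linarith
    have h9 : ε * K * ‖x‖ ≤ ‖b₁‖ / 2 * ‖x‖ := by gcongr
    have h10 : ‖x‖ ≤ 2 * D / ‖b₁‖ := by
      rw [le_div_iff₀ hb']; linarith
    have h11 : ε * ‖x‖ ≤ 1 * ‖x‖ := by gcongr
    linarith
  subst hb1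
  have hb2 : b₂ ≠ 0 := by
    rintro rfl
    obtain ⟨x, hx⟩ := hpt (b₃ + 1)
    have h1 : (x, b₃ + 1) ∈ L '' {z : ℂ × ℂ | G z < c} := by rw [hLΩ]; exact hx
    obtain ⟨z, -, hz⟩ := h1
    rw [hL] at hz
    have := congrArg Prod.snd hz
    simp at this
  have hm0 : ∀ x y : ℂ, G (x, y) < c → G (a₁ * x + a₂ * y + a₃, b₂ * y + b₃) < c := by
    intro x y h
    have := hmaps _ h
    rw [hL] at this
    simpa using this
  have step := key_step d hd a ha p hpm hpd H hH G hGcont hGlim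
  obtain ⟨k₀, e0, hm1⟩ := step c hc _ _ _ _ _ hm0
  obtain ⟨k₁, e1, hm2⟩ := step (d * c) (by positivity) _ _ _ _ _ hm1
  obtain ⟨k₂, e2, hm3⟩ := step (d * (d * c)) (by positivity) _ _ _ _ _ hm2
  obtain ⟨k₃, e3, hm4⟩ := step (d * (d * (d * c))) (by positivity) _ _ _ _ _ hm3
  have cc := comp_coeffs d hd p hpm hpd hpc
  have c1 := cc a₁ k₀ b₂ 0 (k₁ + a * b₃) (fun y => by linear_combination e1 y)
  have ha1 : a₁ ≠ 0 := by
    rintro rfl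
    apply hb2
    rw [← c1.1]; exact zero_pow (by omega)
  have hk0 : k₀ = 0 := c1.2 ha1 rfl
  subst hk0
  have c2 := cc b₂ k₁ a₁ 0 k₂ (fun y => by linear_combination e2 y)
  have hk1 : k₁ = 0 := c2.2 hb2 rfl
  subst hk1
  have c3 := cc a₁ k₂ b₂ 0 k₃ (fun y => by linear_combination e3 y)
  have hk2 : k₂ = 0 := c3.2 ha1 rfl
  subst hk2
  have hp0' : p.eval 0 ≠ 0 := by rwa [← Polynomial.coeff_zero_eq_eval_zero]
  have ha11 : a₁ = 1 := by
    have h := e2 0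
    simp only [mul_zero, add_zero, sub_zero] at h
    have h' : (1 - a₁) * p.eval 0 = 0 := by linear_combination h
    rcases mul_eq_zero.mp h' with h'' | h''
    · linear_combination -h''
    · exact absurd h'' hp0'
  subst ha11
  have hb21 : b₂ = 1 := by rw [← c1.1, one_pow]
  subst hb21
  have hb3 : b₃ = 0 := by
    have h := e1 0
    simp only [mul_zero, add_zero, sub_zero, one_mul, sub_self, zero_sub, neg_eq_zero] at h
    exact (mul_eq_zero.mp h).resolve_left ha
  subst hb3
  have ha3 : a₃ = 0 := by
    have h := e0 0
    simp only [mul_zero, add_zero, sub_zero, one_mul, sub_self, zero_sub, neg_eq_zero] at h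
    exact (mul_eq_zero.mp h).resolve_left ha
  subst ha3
  have ha2 : a₂ = 0 := by
    have h := e0 1
    simp only [mul_zero, add_zero, sub_zero, one_mul, mul_one, sub_self, zero_sub,
      neg_eq_zero] at h
    exact (mul_eq_zero.mp h).resolve_left ha
  subst ha2
  funext z
  rw [hL]
  simp
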